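/- Assume the data (V, a, α, p₀, p₁, λ) forms an admissible spectral curve. Then λ is absolutely continuous with respect to Lebesgue measure on ℝ, its density is bounded, and its support is a finite union of disjoint compact intervals: supp λ = ⋃_{k=1}^{l} [a_k, b_k] with a₁ < b₁ < a₂ < b₂ < ⋯ < a_l < b_l. -/

import Mathlib

open MeasureTheory Polynomial

noncomputable section

/-- The Cauchy transform `C^λ(z) = ∫ dλ(s)/(s − z)` of a measure on `ℝ`. -/
def cauchyT (lam : Measure ℝ) (z : ℂ) : ℂ := ∫ s : ℝ, ((s : ℂ) - z)⁻¹ ∂lam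

/-- The solution `ξ₁(z) = C^λ(z) + V′(z)`. -/
def xi1 (V : Polynomial ℝ) (lam : Measure ℝ) (z : ℂ) : ℂ :=
  cauchyT lam z + Polynomial.aeval z V.derivative

/-- The coefficient `v_k` in `V(z) = ∑_{k=1}^m (v_k/k) z^k`, i.e. `v_k = k·(coeff of z^k)`. -/
def vcoef (V : Polynomial ℝ) (k : ℕ) : ℝ := (k : ℝ) * V.coeff k

/-- An **admissible spectral curve**: an irreducible real cubic
`ξ³ − V′(z)ξ² + p₁(z)ξ + p₀(z) = 0` with `deg p₁ ≤ m−2`,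
`p₀(z) = v_m a² z^{m−1} + (v_{m−1}a² + v_m a(2α−1)) z^{m−2} + …`, one of whose
solutions is `ξ₁(z) = C^λ(z) + V′(z)` for a probability measure `λ` on `ℝ`. -/
structure AdmissibleSpectralCurve (V : Polynomial ℝ) (a α : ℝ) (p₀ p₁ : Polynomial ℝ)
    (lam : Measure ℝ) : Prop where
  hdeg : 2 ≤ V.natDegree
  hconst : V.coeff 0 = 0
  ha : 0 < a
  halpha0 : 0 < α
  halpha1 : α < 1
  hirr : Irreducible (Polynomial.X ^ 3 + Polynomial.C (-V.derivative) * Polynomial.X ^ 2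
    + Polynomial.C p₁ * Polynomial.X + Polynomial.C p₀ : Polynomial (Polynomial ℝ))
  hp₁ : p₁.degree ≤ ((V.natDegree - 2 : ℕ) : WithBot ℕ)
  hp₀deg : p₀.natDegree ≤ V.natDegree - 1
  hp₀top : p₀.coeff (V.natDegree - 1) = vcoef V V.natDegree * a ^ 2
  hp₀next : p₀.coeff (V.natDegree - 2)
    = vcoef V (V.natDegree - 1) * a ^ 2 + vcoef V V.natDegree * a * (2 * α - 1)
  hprob : IsProbabilityMeasure lam
  hsol : ∀ z : ℂ, z.im ≠ 0 →
    xi1 V lam z ^ 3 - Polynomial.aeval z V.derivative * xi1 V lam z ^ 2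
      + Polynomial.aeval z p₁ * xi1 V lam z + Polynomial.aeval z p₀ = 0

open Set Filter Topology

lemma norm_cauchy_kernel_le (s : ℝ) {z : ℂ} (hz : z.im ≠ 0) :
    ‖((s : ℂ) - z)⁻¹‖ ≤ |z.im|⁻¹ := by
  rw [norm_inv]
  refine inv_anti₀ (abs_pos.2 hz) ?_
  simpa using Complex.abs_im_le_norm ((s : ℂ) - z)

lemma integrable_cauchy_kernel (lam : Measure ℝ) [IsFiniteMeasure lam] {z : ℂ} (hz : z.im ≠ 0) :
    Integrable (fun s : ℝ => ((s : ℂ) - z)⁻¹) lam := by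
  refine Integrable.of_bound (C := |z.im|⁻¹) ?_
    (Eventually.of_forall fun s => norm_cauchy_kernel_le s hz)
  exact (by fun_prop : Measurable fun s : ℝ => ((s : ℂ) - z)⁻¹).aestronglyMeasurable

lemma cauchy_kernel_im (s : ℝ) (z : ℂ) :
    (((s : ℂ) - z)⁻¹).im = z.im / ((s - z.re) ^ 2 + z.im ^ 2) := by
  rw [Complex.inv_im, Complex.normSq_apply]
  simp
  ring_nf

lemma integrable_poisson_kernel (lam : Measure ℝ) [IsFiniteMeasure lam] {z : ℂ}
    (hz : z.im ≠ 0) : Integrable (fun s : ℝ => z.im / ((s - z.re) ^ 2 + z.im ^ 2)) lam := by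
  refine (integrable_cauchy_kernel lam hz).im.congr (Eventually.of_forall fun s => ?_)
  exact cauchy_kernel_im s z

lemma cauchyT_im (lam : Measure ℝ) [IsFiniteMeasure lam] {z : ℂ} (hz : z.im ≠ 0) :
    (cauchyT lam z).im = ∫ s : ℝ, z.im / ((s - z.re) ^ 2 + z.im ^ 2) ∂lam := by
  have := Complex.imCLM.integral_comp_comm (integrable_cauchy_kernel lam hz)
  simp only [Complex.imCLM_apply, cauchy_kernel_im] at this
  exact this.symm

lemma cauchyT_im_nonneg (lam : Measure ℝ) [IsFiniteMeasure lam] {z : ℂ} (hz : 0 < z.im) :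
    0 ≤ (cauchyT lam z).im := by
  rw [cauchyT_im lam hz.ne']
  exact integral_nonneg fun s => by positivity

lemma continuousAt_cauchyT (lam : Measure ℝ) [IsFiniteMeasure lam] {z : ℂ} (hz : 0 < z.im) :
    ContinuousAt (cauchyT lam) z := by
  have hev : ∀ᶠ w : ℂ in 𝓝 z, z.im / 2 < w.im :=
    Complex.continuous_im.continuousAt.eventually (lt_mem_nhds (half_lt_self hz))
  refine continuousAt_of_dominated (bound := fun _ => (z.im / 2)⁻¹) ?_ ?_ (integrable_const _) ?_
  · filter_upwards [hev] with w hw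
    exact (integrable_cauchy_kernel lam (by linarith : 0 < w.im).ne').aestronglyMeasurable
  · filter_upwards [hev] with w hw
    refine Eventually.of_forall fun s =>
      (norm_cauchy_kernel_le s (by linarith : 0 < w.im).ne').trans ?_
    exact inv_anti₀ (by linarith) (hw.le.trans (le_abs_self _))
  · refine Eventually.of_forall fun s => ?_
    refine ContinuousAt.inv₀ (by fun_prop) fun h => hz.ne' ?_
    simpa using congrArg Complex.im h

/-- The mass of an interval is controlled by the Poisson integral at its half-width. -/
lemma measureReal_Icc_le_cauchyT_im (lam : Measure ℝ) [IsFiniteMeasure lam] (x : ℝ) {y : ℝ}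
    (hy : 0 < y) : lam.real (Icc (x - y) (x + y)) ≤ 2 * y * (cauchyT lam ⟨x, y⟩).im := by
  have hz : (⟨x, y⟩ : ℂ).im ≠ 0 := hy.ne'
  have hker := integrable_poisson_kernel lam hz
  rw [cauchyT_im lam hz, ← integral_const_mul, ← integral_indicator_one measurableSet_Icc]
  refine integral_mono ((integrable_const (1 : ℝ)).indicator measurableSet_Icc)
    (hker.const_mul _) fun s => ?_
  by_cases hs : s ∈ Icc (x - y) (x + y)
  · rw [indicator_of_mem hs]
    have h1 : (s - x) ^ 2 ≤ y ^ 2 := sq_le_sq' (by linarith [hs.1]) (by linarith [hs.2])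
    simp only [Pi.one_apply]
    rw [← mul_div_assoc, le_div_iff₀ (by positivity)]
    nlinarith
  · rw [indicator_of_notMem hs]
    positivity

/-- If a neighbourhood of `x` is null, the Poisson integral above `x` is `O(y)`. -/
lemma cauchyT_im_le_of_null (lam : Measure ℝ) [IsProbabilityMeasure lam] {x r y : ℝ}
    (hr : 0 < r) (hy : 0 < y) (h : lam (Ioo (x - r) (x + r)) = 0) :
    (cauchyT lam ⟨x, y⟩).im ≤ y / r ^ 2 := by
  have hz : (⟨x, y⟩ : ℂ).im ≠ 0 := hy.ne'
  rw [cauchyT_im lam hz]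
  have : ∫ _ : ℝ, y / r ^ 2 ∂lam = y / r ^ 2 := by simp
  rw [← this]
  refine integral_mono_ae (integrable_poisson_kernel lam hz) (integrable_const _) ?_
  filter_upwards [measure_eq_zero_iff_ae_notMem.1 h] with s hs
  have h1 : r ^ 2 ≤ (s - x) ^ 2 := by
    rw [sq_le_sq, abs_of_pos hr, le_abs]
    by_contra! hc
    exact hs ⟨by linarith, by linarith⟩
  exact div_le_div_of_nonneg_left hy.le (by positivity) (by nlinarith [sq_nonneg y])

lemma measureReal_Ioc_eq_sub (lam : Measure ℝ) [IsFiniteMeasure lam] {p q : ℝ} (hpq : p ≤ q) :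
    lam.real (Ioc p q) = lam.real (Iic q) - lam.real (Iic p) := by
  rw [← measureReal_sdiff (Iic_subset_Iic.2 hpq) measurableSet_Iic]
  congr 1
  ext s
  simp [and_comm]

/-- If the Poisson integral vanishes in the limit above every point of an open interval,
the measure vanishes there. -/
lemma measure_Ioc_eq_zero_of_tendsto (lam : Measure ℝ) [IsFiniteMeasure lam] {c d p q : ℝ}
    (h : ∀ x ∈ Ioo c d, Tendsto (fun y : ℝ => (cauchyT lam ⟨x, y⟩).im) (𝓝[>] 0) (𝓝 0))
    (hp : p ∈ Ioo c d) (hq : q ∈ Ioo c d) (hpq : p ≤ q) : lam (Ioc p q) = 0 := by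
  set F : ℝ → ℝ := fun x => lam.real (Iic x) with hF
  have hdiff : ∀ p q, p ≤ q → F q - F p = lam.real (Ioc p q) := fun p q hpq =>
    (measureReal_Ioc_eq_sub lam hpq).symm
  have hder : ∀ x ∈ Ioo c d, HasDerivAt F 0 x := by
    intro x hx
    rw [hasDerivAt_iff_isLittleO_nhds_zero, Asymptotics.isLittleO_iff]
    intro ε hε
    have h1 : ∀ᶠ y : ℝ in 𝓝[>] 0, 2 * (cauchyT lam ⟨x, y⟩).im < ε := by
      have := (h x hx).const_mul 2
      rw [mul_zero] at this
      exact this.eventually (gt_mem_nhds hε)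
    rw [eventually_nhdsWithin_iff] at h1
    have h2 : Tendsto (fun t : ℝ => |t|) (𝓝 0) (𝓝 0) := by
      simpa using (continuous_abs.tendsto (0 : ℝ))
    filter_upwards [h2.eventually h1] with t ht
    rcases eq_or_ne t 0 with rfl | ht0
    · simp
    have htp : 0 < |t| := abs_pos.2 ht0
    have h3 := measureReal_Icc_le_cauchyT_im lam x htp
    have h4 : |F (x + t) - F x| ≤ lam.real (Icc (x - |t|) (x + |t|)) := by
      rcases le_total 0 t with h0 | h0
      · rw [hdiff _ _ (by linarith), abs_of_nonneg measureReal_nonneg, abs_of_nonneg h0]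
        exact measureReal_mono fun s hs => ⟨by linarith [hs.1], hs.2⟩
      · rw [abs_sub_comm, hdiff _ _ (by linarith), abs_of_nonneg measureReal_nonneg,
          abs_of_nonpos h0]
        exact measureReal_mono fun s hs => ⟨by linarith [hs.1], by linarith [hs.2]⟩
    simp only [smul_zero, sub_zero, Real.norm_eq_abs]
    have h5 := ht htp
    nlinarith
  have hc : F p = F q := isOpen_Ioo.is_const_of_deriv_eq_zero isPreconnected_Ioo
    (fun x hx => (hder x hx).differentiableAt.differentiableWithinAt)
    (fun x hx => (hder x hx).deriv) hp hq
  have := hdiff p q hpq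
  rw [hc, sub_self] at this
  exact (measureReal_eq_zero_iff).1 this.symm

/-- A probability measure whose distribution function is Lipschitz has a bounded density. -/
lemma exists_bounded_density (lam : Measure ℝ) [IsProbabilityMeasure lam] (M : NNReal)
    (h : ∀ p q, p ≤ q → lam.real (Ioc p q) ≤ M * (q - p)) :
    ∃ f : ℝ → ℝ, Measurable f ∧ (∀ x, 0 ≤ f x) ∧ (∀ x, f x ≤ M) ∧
      lam = volume.withDensity (fun x => ENNReal.ofReal (f x)) := by
  let F := ProbabilityTheory.cdf lam
  have hF : ∀ x, F x = lam.real (Iic x) := ProbabilityTheory.cdf_eq_real lam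
  let G : StieltjesFunction ℝ :=
    { toFun := fun x => M * x - F x
      mono' := by
        intro p q hpq
        have := h p q hpq
        rw [measureReal_Ioc_eq_sub lam hpq, ← hF, ← hF] at this
        change M * p - F p ≤ M * q - F q
        linarith
      right_continuous' := fun x =>
        (by fun_prop : ContinuousWithinAt (fun x : ℝ => M * x) (Ici x) x).sub
          (F.right_continuous x) }
  have hsum : F + G = M • StieltjesFunction.id := by
    ext x
    change F x + (M * x - F x) = M * x
    ring
  have hle : lam ≤ M • (volume : Measure ℝ) := by
    have h1 : F.measure + G.measure = M • StieltjesFunction.id.measure := by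
      rw [← StieltjesFunction.measure_add, hsum, StieltjesFunction.measure_smul]
    rw [ProbabilityTheory.measure_cdf, ← Real.volume_eq_stieltjes_id] at h1
    rw [← h1]
    exact Measure.le_add_right le_rfl
  have hac : lam ≪ volume := Measure.absolutelyContinuous_of_le_smul (c := M) hle
  have hae : ∀ᵐ x, lam.rnDeriv volume x ≤ M := by
    refine ae_le_of_forall_setLIntegral_le_of_sigmaFinite (Measure.measurable_rnDeriv _ _)
      fun s hs _ => ?_
    refine (Measure.setLIntegral_rnDeriv_le s).trans ?_
    refine (hle s).trans_eq ?_
    rw [setLIntegral_const]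
    rfl
  refine ⟨fun x => min (lam.rnDeriv volume x).toReal M, by fun_prop, fun x => by positivity,
    fun x => min_le_right _ _, ?_⟩
  conv_lhs => rw [← Measure.withDensity_rnDeriv_eq lam volume hac]
  refine withDensity_congr_ae ?_
  filter_upwards [hae] with x hx
  have hx' : (lam.rnDeriv volume x).toReal ≤ M := ENNReal.toReal_mono ENNReal.coe_ne_top hx
  rw [min_eq_left hx', ENNReal.ofReal_toReal (ne_top_of_le_ne_top ENNReal.coe_ne_top hx)]

lemma IsPreconnected.subset_or_subset_compl_of_disjoint_frontier {X : Type*} [TopologicalSpace X]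
    {s K : Set X} (hs : IsPreconnected s) (hK : IsClosed K) (h : Disjoint s (frontier K)) :
    s ⊆ K ∨ s ⊆ Kᶜ := by
  have hcov : s ⊆ interior K ∪ Kᶜ := fun x hx => by
    by_cases hxK : x ∈ K
    · refine Or.inl ?_
      by_contra hxi
      exact disjoint_left.1 h hx (hK.frontier_eq ▸ ⟨hxK, hxi⟩)
    · exact Or.inr hxK
  have hdisj : Disjoint (interior K) Kᶜ := disjoint_compl_right.mono_left interior_subset
  exact (hs.subset_or_subset isOpen_interior hK.isOpen_compl hdisj hcov).imp_left
    fun h => h.trans interior_subset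

/-- A compact subset of the line with finite frontier and no isolated points is a finite disjoint
union of nondegenerate compact intervals. -/
lemma IsCompact.exists_eq_iUnion_Icc {K : Set ℝ} (hK : IsCompact K) (hfin : (frontier K).Finite)
    (hacc : ∀ x ∈ K, ∀ ε > 0, ∃ y ∈ K, y ≠ x ∧ |y - x| < ε) :
    ∃ (l : ℕ) (A B : Fin l → ℝ), (∀ i, A i < B i) ∧
      (∀ i j : Fin l, (i : ℕ) < (j : ℕ) → B i < A j) ∧ K = ⋃ i, Icc (A i) (B i) := by
  induction hn : (frontier K).ncard using Nat.strong_induction_on generalizing K with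
  | _ n ih =>
  rcases K.eq_empty_or_nonempty with rfl | hne
  · exact ⟨0, Fin.elim0, Fin.elim0, fun i => i.elim0, fun i => i.elim0, by simp⟩
  have hcl := hK.isClosed
  have hfr : frontier K = K \ interior K := hcl.frontier_eq
  obtain ⟨a, haK, ha⟩ := hK.exists_isLeast hne
  obtain ⟨m, hmK, hm⟩ := hK.exists_isGreatest hne
  have ham : a < m := by
    obtain ⟨y, hy, hya, -⟩ := hacc a haK 1 one_pos
    exact (lt_of_le_of_ne (ha hy) (Ne.symm hya)).trans_le (hm hy)
  have hmfr : m ∈ frontier K := by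
    rw [hfr]
    refine ⟨hmK, fun hmi => ?_⟩
    obtain ⟨ε, hε, hsub⟩ := Metric.isOpen_iff.1 isOpen_interior m hmi
    have h1 : m + ε / 2 ∈ Metric.ball m ε := by
      rw [Metric.mem_ball, Real.dist_eq, add_sub_cancel_left, abs_of_pos (by linarith)]
      linarith
    have h2 : m + ε / 2 ≤ m := hm (interior_subset (hsub h1))
    linarith
  obtain ⟨b, ⟨hbfr, hab⟩, hbmin⟩ := exists_min_image (frontier K ∩ Ioi a) id
    (hfin.subset inter_subset_left) ⟨m, hmfr, ham⟩
  simp only [mem_Ioi, id] at hab hbmin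
  have hIoo : Ioo a b ⊆ K := by
    obtain ⟨y, hyK, hya, hyb⟩ := hacc a haK (b - a) (sub_pos.2 hab)
    have hy : y ∈ Ioo a b :=
      ⟨lt_of_le_of_ne (ha hyK) (Ne.symm hya), by linarith [le_abs_self (y - a)]⟩
    refine (isPreconnected_Ioo.subset_or_subset_compl_of_disjoint_frontier hcl
      (disjoint_left.2 fun x hx hxf => ?_)).resolve_right fun h => h hy hyK
    exact (hbmin x ⟨hxf, hx.1⟩).not_gt hx.2
  have hIcc : Icc a b ⊆ K := by
    rw [← closure_Ioo hab.ne]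
    exact closure_minimal hIoo hcl
  obtain ⟨ε, hε, hball⟩ : ∃ ε > 0, Metric.ball b ε ⊆ (frontier K \ {b})ᶜ :=
    Metric.isOpen_iff.1 (hfin.subset sdiff_subset).isClosed.isOpen_compl b (by simp)
  have hgap : Ioo b (b + ε) ⊆ Kᶜ := by
    refine (isPreconnected_Ioo.subset_or_subset_compl_of_disjoint_frontier hcl
      (disjoint_left.2 fun x hx hxf => ?_)).resolve_left fun h => ?_
    · refine hball ?_ ⟨hxf, hx.1.ne'⟩
      rw [Metric.mem_ball, Real.dist_eq, abs_of_pos (by linarith [hx.1])]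
      linarith [hx.2]
    · rw [hfr] at hbfr
      refine hbfr.2 (mem_interior.2 ⟨Ioo a (b + ε), fun x hx => ?_, isOpen_Ioo, hab, by linarith⟩)
      rcases le_or_gt x b with hxb | hxb
      · exact hIcc ⟨hx.1.le, hxb⟩
      · exact h ⟨hxb, hx.2⟩
  have hK' : K ∩ Ici (b + ε) = K ∩ Ioi b := by
    ext x
    refine and_congr_right fun hx => ⟨fun h => ?_, fun h => ?_⟩
    · rw [mem_Ici] at h
      rw [mem_Ioi]
      linarith
    · by_contra hc
      exact hgap ⟨h, not_le.1 hc⟩ hx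
  have hcomp : IsCompact (K ∩ Ioi b) := hK' ▸ hK.inter_right isClosed_Ici
  have hfr' : frontier (K ∩ Ioi b) ⊆ frontier K \ {b} := by
    intro x hx
    rw [hcomp.isClosed.frontier_eq] at hx
    refine ⟨hfr ▸ ⟨hx.1.1, fun hxi => hx.2 ?_⟩, ne_of_gt hx.1.2⟩
    rw [interior_inter, isOpen_Ioi.interior_eq]
    exact ⟨hxi, hx.1.2⟩
  obtain ⟨l, A, B, hAB, hBA, hKl⟩ := ih _
    (hn ▸ ncard_lt_ncard ⟨hfr'.trans sdiff_subset, fun h => (hfr' (h hbfr)).2 rfl⟩ hfin)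
    hcomp (hfin.subset (hfr'.trans sdiff_subset))
    (fun x hx δ hδ => by
      obtain ⟨y, hyK, hyx, hy⟩ := hacc x hx.1 (min δ (x - b)) (lt_min hδ (sub_pos.2 hx.2))
      refine ⟨y, ⟨hyK, ?_⟩, hyx, hy.trans_le (min_le_left _ _)⟩
      rw [mem_Ioi]
      linarith [neg_abs_le (y - x), min_le_right δ (x - b)]) rfl
  refine ⟨l + 1, Fin.cons a A, Fin.cons b B, Fin.cases hab hAB, ?_, ?_⟩
  · intro i j hij
    induction j using Fin.cases with
    | zero => simp at hij
    | succ j =>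
      induction i using Fin.cases with
      | zero =>
        have : A j ∈ K ∩ Ioi b := hKl ▸ mem_iUnion.2 ⟨j, le_rfl, (hAB j).le⟩
        simpa using this.2
      | succ i => simpa using hBA i j (by simpa using hij)
  · have hsplit : K = Icc a b ∪ (K ∩ Ioi b) := by
      ext x
      refine ⟨fun hx => ?_, fun hx => hx.elim (fun h => hIcc h) fun h => h.1⟩
      rcases le_or_gt x b with h | h
      · exact Or.inl ⟨ha hx, h⟩
      · exact Or.inr ⟨hx, h⟩
    rw [hKl] at hsplit
    rw [hsplit]
    ext x
    simp [Fin.exists_fin_succ]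

/-- The discriminant of a real cubic, expressed through a nonreal root. -/
lemma cubic_discr_eq_of_root {b c d : ℝ} {w : ℂ} (hw : w.im ≠ 0)
    (h : w ^ 3 + b * w ^ 2 + c * w + d = 0) :
    b ^ 2 * c ^ 2 - 4 * c ^ 3 - 4 * b ^ 3 * d - 27 * d ^ 2 + 18 * b * c * d =
      -(4 * w.im ^ 2 * ((3 * w.re + b) ^ 2 + w.im ^ 2) ^ 2) := by
  obtain ⟨s, t⟩ := w
  have hre := congrArg Complex.re h
  have him := congrArg Complex.im h
  simp [pow_succ] at hre him hw
  have hc : c = t ^ 2 - 3 * s ^ 2 - 2 * b * s := by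
    refine mul_right_cancel₀ hw ?_
    linear_combination him
  subst hc
  have hd : d = -(s ^ 3 - 3 * s * t ^ 2 + b * (s ^ 2 - t ^ 2)
      + (t ^ 2 - 3 * s ^ 2 - 2 * b * s) * s) := by
    linear_combination hre
  subst hd
  ring

lemma norm_le_of_cubic_root {b c d w : ℂ} (h : w ^ 3 + b * w ^ 2 + c * w + d = 0) :
    ‖w‖ ≤ 1 + ‖b‖ + ‖c‖ + ‖d‖ := by
  by_contra! hlt
  have hb := norm_nonneg b
  have hc := norm_nonneg c
  have hd := norm_nonneg d
  have h1 : 1 ≤ ‖w‖ := by linarith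
  have h2 : w ^ 3 = -(b * w ^ 2 + c * w + d) := by linear_combination h
  have h3 : ‖w‖ ^ 3 ≤ ‖b‖ * ‖w‖ ^ 2 + ‖c‖ * ‖w‖ + ‖d‖ := by
    rw [← norm_pow, h2, norm_neg]
    refine (norm_add₃_le).trans_eq ?_
    simp
  have h4 : ‖c‖ * ‖w‖ ≤ ‖c‖ * ‖w‖ ^ 2 := mul_le_mul_of_nonneg_left (by nlinarith) hc
  have h5 : ‖d‖ ≤ ‖d‖ * ‖w‖ ^ 2 := le_mul_of_one_le_right hd (by nlinarith)
  have h6 : 0 < ‖w‖ ^ 2 := by positivity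
  nlinarith

/-- Nonreal roots of a real cubic stay away from the real axis, quantitatively in terms of the
discriminant. -/
lemma abs_cubic_discr_le_of_root {b c d : ℝ} {w : ℂ} (hw : w.im ≠ 0)
    (h : w ^ 3 + b * w ^ 2 + c * w + d = 0) :
    |b ^ 2 * c ^ 2 - 4 * c ^ 3 - 4 * b ^ 3 * d - 27 * d ^ 2 + 18 * b * c * d| ≤
      w.im ^ 2 * (4 * ((4 * (1 + |b| + |c| + |d|)) ^ 2 + (1 + |b| + |c| + |d|) ^ 2) ^ 2) := by
  have hn := norm_le_of_cubic_root h
  simp only [Complex.norm_real, Real.norm_eq_abs] at hn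
  rw [cubic_discr_eq_of_root hw h, abs_neg, abs_of_nonneg (by positivity)]
  set Q := 1 + |b| + |c| + |d| with hQ
  have hs : |w.re| ≤ Q := (Complex.abs_re_le_norm w).trans hn
  have ht : |w.im| ≤ Q := (Complex.abs_im_le_norm w).trans hn
  have hbQ : |b| ≤ Q := by linarith [abs_nonneg c, abs_nonneg d]
  have h1 : (3 * w.re + b) ^ 2 ≤ (4 * Q) ^ 2 := by
    obtain ⟨hs1, hs2⟩ := abs_le.1 hs
    obtain ⟨hb1, hb2⟩ := abs_le.1 hbQ
    exact sq_le_sq' (by linarith) (by linarith)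
  have h2 : w.im ^ 2 ≤ Q ^ 2 := sq_le_sq' (by linarith [(abs_le.1 ht).1]) (abs_le.1 ht).2
  have h3 : ((3 * w.re + b) ^ 2 + w.im ^ 2) ^ 2 ≤ ((4 * Q) ^ 2 + Q ^ 2) ^ 2 :=
    pow_le_pow_left₀ (by positivity) (add_le_add h1 h2) 2
  nlinarith [sq_nonneg w.im]

lemma Polynomial.exists_eval_pos_of_even {P : ℝ[X]} {n : ℕ} (hn : 0 < n) (he : Even n)
    (hle : P.natDegree ≤ n) (hc : 0 < P.coeff n) : ∃ R : ℝ, ∀ x, R ≤ |x| → 0 < P.eval x := by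
  have hdeg : P.natDegree = n := natDegree_eq_of_le_of_coeff_ne_zero hle hc.ne'
  have htop : ∀ Q : ℝ[X], Q.natDegree = n → 0 < Q.leadingCoeff →
      ∀ᶠ x in atTop, 0 < Q.eval x := fun Q hQ hl =>
    (Q.tendsto_atTop_of_leadingCoeff_nonneg
      (natDegree_pos_iff_degree_pos.1 (hQ ▸ hn)) hl.le).eventually_gt_atTop 0
  have h1 := htop P hdeg (by rwa [leadingCoeff, hdeg])
  have h2 := htop (P.comp (-X)) (by simp [natDegree_comp, hdeg])
    (by rw [leadingCoeff_comp (by simp), hdeg]; simpa [he.neg_one_pow, leadingCoeff, hdeg] using hc)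
  obtain ⟨R, hR⟩ := eventually_atTop.1 (h1.and h2)
  refine ⟨R, fun x hx => ?_⟩
  rcases le_total 0 x with h0 | h0
  · exact (hR x (by rwa [abs_of_nonneg h0] at hx)).1
  · simpa using (hR (-x) (by rwa [abs_of_nonpos h0] at hx)).2

/-- The discriminant of `ξ³ − U ξ² + p₁ ξ + p₀` as a polynomial in the base variable. -/
def spectralDiscr (U p₀ p₁ : ℝ[X]) : ℝ[X] :=
  U ^ 2 * p₁ ^ 2 - C 4 * p₁ ^ 3 + C 4 * (U ^ 3 * p₀) - C 27 * p₀ ^ 2 - C 18 * (U * p₁ * p₀)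

lemma exists_spectralDiscr_pos {U p₀ p₁ : ℝ[X]} {n : ℕ} {u a : ℝ} (hn : 0 < n)
    (hU : U.natDegree ≤ n) (hu : U.coeff n = u) (hu0 : u ≠ 0) (ha : 0 < a)
    (h₁ : p₁.natDegree ≤ n - 1) (h₀ : p₀.natDegree ≤ n) (hc : p₀.coeff n = u * a ^ 2) :
    ∃ R : ℝ, ∀ x, R ≤ |x| → 0 < (spectralDiscr U p₀ p₁).eval x := by
  have hA : (U ^ 2 * p₁ ^ 2).natDegree ≤ 2 * n + 2 * (n - 1) :=
    natDegree_mul_le_of_le (natDegree_pow_le_of_le 2 hU) (natDegree_pow_le_of_le 2 h₁)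
  have hB : (C 4 * p₁ ^ 3).natDegree ≤ 3 * (n - 1) :=
    (natDegree_C_mul_le _ _).trans (natDegree_pow_le_of_le 3 h₁)
  have hD : (C 4 * (U ^ 3 * p₀)).natDegree ≤ 3 * n + n :=
    (natDegree_C_mul_le _ _).trans (natDegree_mul_le_of_le (natDegree_pow_le_of_le 3 hU) h₀)
  have hE : (C 27 * p₀ ^ 2).natDegree ≤ 2 * n :=
    (natDegree_C_mul_le _ _).trans (natDegree_pow_le_of_le 2 h₀)
  have hF : (C 18 * (U * p₁ * p₀)).natDegree ≤ n + (n - 1) + n :=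
    (natDegree_C_mul_le _ _).trans (natDegree_mul_le_of_le (natDegree_mul_le_of_le hU h₁) h₀)
  refine Polynomial.exists_eval_pos_of_even (n := 3 * n + n) (by omega) ⟨2 * n, by ring⟩ ?_ ?_
  · refine natDegree_sub_le_of_le (natDegree_sub_le_of_le (natDegree_add_le_of_le
      (natDegree_sub_le_of_le ?_ ?_) ?_) ?_) ?_ |>.trans (b := max (max (max (max (3 * n + n)
      (3 * n + n)) (3 * n + n)) (3 * n + n)) (3 * n + n)) (by simp)
    all_goals omega
  · have hlead : (U ^ 3 * p₀).coeff (3 * n + n) = u ^ 3 * (u * a ^ 2) := by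
      rw [coeff_mul_add_eq_of_natDegree_le (natDegree_pow_le_of_le 3 hU) h₀, hc,
        coeff_pow_of_natDegree_le hU, hu]
    rw [spectralDiscr]
    simp only [coeff_sub, coeff_add]
    rw [coeff_eq_zero_of_natDegree_lt (hA.trans_lt (by omega)),
      coeff_eq_zero_of_natDegree_lt (hB.trans_lt (by omega)),
      coeff_eq_zero_of_natDegree_lt (hE.trans_lt (by omega)),
      coeff_eq_zero_of_natDegree_lt (hF.trans_lt (by omega)), coeff_C_mul, hlead]
    have : 0 < 4 * (u ^ 4 * a ^ 2) := by positivity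
    linarith

/-- A root `w` of the cubic over the base point `z`, shifted by `U z`. -/
def IsShiftedRoot (U p₀ p₁ : ℝ[X]) (z w : ℂ) : Prop :=
  (w + aeval z U) ^ 3 - aeval z U * (w + aeval z U) ^ 2 + aeval z p₁ * (w + aeval z U)
    + aeval z p₀ = 0

/-- An upper bound for the norms of the shifted roots over `z`. -/
def shiftedRootBound (U p₀ p₁ : ℝ[X]) (z : ℂ) : ℝ :=
  1 + ‖aeval z U‖ + ‖aeval z p₁‖ + ‖aeval z p₀‖ + ‖aeval z U‖

lemma continuous_shiftedRootBound (U p₀ p₁ : ℝ[X]) : Continuous (shiftedRootBound U p₀ p₁) := by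
  unfold shiftedRootBound
  fun_prop

lemma IsShiftedRoot.norm_le {U p₀ p₁ : ℝ[X]} {z w : ℂ} (h : IsShiftedRoot U p₀ p₁ z w) :
    ‖w‖ ≤ shiftedRootBound U p₀ p₁ z := by
  have h1 := norm_le_of_cubic_root (b := -aeval z U) (c := aeval z p₁) (d := aeval z p₀)
    (w := w + aeval z U) (by rw [← h]; ring)
  rw [norm_neg] at h1
  have h2 := norm_sub_le (w + aeval z U) (aeval z U)
  rw [add_sub_cancel_right] at h2
  unfold shiftedRootBound
  linarith

lemma isClosed_setOf_isShiftedRoot (U p₀ p₁ : ℝ[X]) :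
    IsClosed {q : ℂ × ℂ | IsShiftedRoot U p₀ p₁ q.1 q.2} :=
  isClosed_eq (by fun_prop) continuous_const

lemma IsShiftedRoot.cubic_root {U p₀ p₁ : ℝ[X]} {x : ℝ} {w : ℂ}
    (h : IsShiftedRoot U p₀ p₁ x w) :
    (w + (U.eval x : ℝ)) ^ 3 + (-U.eval x : ℝ) * (w + (U.eval x : ℝ)) ^ 2
      + (p₁.eval x : ℝ) * (w + (U.eval x : ℝ)) + (p₀.eval x : ℝ) = 0 := by
  have haev : ∀ p : ℝ[X], aeval (x : ℂ) p = ((p.eval x : ℝ) : ℂ) := fun p => by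
    simpa using aeval_algebraMap_apply ℂ x p
  rw [IsShiftedRoot, haev, haev, haev] at h
  rw [← h]
  push_cast
  ring

lemma spectralDiscr_eval (U p₀ p₁ : ℝ[X]) (x : ℝ) : (spectralDiscr U p₀ p₁).eval x =
    (-U.eval x) ^ 2 * p₁.eval x ^ 2 - 4 * p₁.eval x ^ 3 - 4 * (-U.eval x) ^ 3 * p₀.eval x
      - 27 * p₀.eval x ^ 2 + 18 * (-U.eval x) * p₁.eval x * p₀.eval x := by
  simp [spectralDiscr]
  ring

lemma IsShiftedRoot.im_eq_zero {U p₀ p₁ : ℝ[X]} {x : ℝ} {w : ℂ}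
    (h : IsShiftedRoot U p₀ p₁ x w) (hD : 0 < (spectralDiscr U p₀ p₁).eval x) : w.im = 0 := by
  by_contra hw
  have h1 := cubic_discr_eq_of_root (by simpa using hw) h.cubic_root
  rw [← spectralDiscr_eval] at h1
  rw [h1] at hD
  have := sq_nonneg (w + (U.eval x : ℝ)).im
  linarith [mul_nonneg (mul_nonneg (by norm_num : (0 : ℝ) ≤ 4) this) (sq_nonneg
    ((3 * (w + (U.eval x : ℝ)).re + -U.eval x) ^ 2 + (w + (U.eval x : ℝ)).im ^ 2))]

/-- Near a point where the discriminant does not vanish, nonreal roots have imaginary parts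
bounded away from zero. -/
lemma exists_eventually_im_eq_zero_or_lt {U p₀ p₁ : ℝ[X]} {x₀ : ℝ}
    (hD : (spectralDiscr U p₀ p₁).eval x₀ ≠ 0) :
    ∃ κ > 0, ∀ᶠ x : ℝ in 𝓝 x₀, ∀ w, IsShiftedRoot U p₀ p₁ x w → w.im = 0 ∨ κ < |w.im| := by
  let Q : ℝ → ℝ := fun x => 1 + |-U.eval x| + |p₁.eval x| + |p₀.eval x|
  let W : ℝ → ℝ := fun x => 4 * ((4 * Q x) ^ 2 + Q x ^ 2) ^ 2
  have hQ : ∀ x, 0 < Q x := fun x => by positivity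
  have hW : ∀ x, 0 < W x := fun x => by have := hQ x; positivity
  have hcont : Continuous fun x => |(spectralDiscr U p₀ p₁).eval x| / W x := by
    refine Continuous.div (by fun_prop) (by fun_prop) fun x => (hW x).ne'
  have hpos : 0 < |(spectralDiscr U p₀ p₁).eval x₀| / W x₀ := div_pos (abs_pos.2 hD) (hW x₀)
  obtain ⟨η, hη, hη2⟩ := exists_between hpos
  refine ⟨√η, Real.sqrt_pos.2 hη, ?_⟩
  filter_upwards [hcont.continuousAt.eventually (lt_mem_nhds hη2)] with x hx w hw
  refine or_iff_not_imp_left.2 fun him => ?_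
  have h1 := abs_cubic_discr_le_of_root (by simpa using him) hw.cubic_root
  rw [← spectralDiscr_eval, ← div_le_iff₀ (hW x)] at h1
  rw [Real.sqrt_lt' (abs_pos.2 him), sq_abs]
  simpa using hx.trans_le h1

section CauchyTransform

variable {U p₀ p₁ : ℝ[X]} {lam : Measure ℝ}

/-- Boundary values of the Cauchy transform are roots of the limiting cubic. -/
lemma exists_isShiftedRoot_of_frequently
    (hsol : ∀ z : ℂ, z.im ≠ 0 → IsShiftedRoot U p₀ p₁ z (cauchyT lam z)) {x : ℂ} {S : Set ℂ}
    (hS : IsClosed S) (hf : ∃ᶠ z in 𝓝[{z | 0 < z.im}] x, cauchyT lam z ∈ S) :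
    ∃ w ∈ S, IsShiftedRoot U p₀ p₁ x w := by
  have hb : ∀ᶠ z in 𝓝[{z | 0 < z.im}] x, shiftedRootBound U p₀ p₁ z <
      shiftedRootBound U p₀ p₁ x + 1 := nhdsWithin_le_nhds <|
    (continuous_shiftedRootBound U p₀ p₁).continuousAt.eventually (gt_mem_nhds (by linarith))
  obtain ⟨z, hz, hzS⟩ := exists_seq_forall_of_frequently
    (hf.and_eventually (hb.and eventually_mem_nhdsWithin))
  have hroot : ∀ n, IsShiftedRoot U p₀ p₁ (z n) (cauchyT lam (z n)) := fun n =>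
    hsol _ (ne_of_gt (hzS n).2.2)
  obtain ⟨w, -, φ, hφ, hw⟩ := tendsto_subseq_of_bounded (x := fun n => cauchyT lam (z n))
    (Metric.isBounded_closedBall (x := (0 : ℂ)) (r := shiftedRootBound U p₀ p₁ x + 1))
    fun n => mem_closedBall_zero_iff.2 ((hroot n).norm_le.trans (hzS n).2.1.le)
  refine ⟨w, hS.mem_of_tendsto hw (Eventually.of_forall fun n => (hzS _).1), ?_⟩
  have hzφ : Tendsto (fun n => z (φ n)) atTop (𝓝 x) :=
    (hz.mono_right nhdsWithin_le_nhds).comp hφ.tendsto_atTop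
  have hmem : (x, w) ∈ {q : ℂ × ℂ | IsShiftedRoot U p₀ p₁ q.1 q.2} :=
    (isClosed_setOf_isShiftedRoot U p₀ p₁).mem_of_tendsto (hzφ.prodMk_nhds hw)
      (Eventually.of_forall fun n => hroot (φ n))
  exact hmem

lemma tendsto_mk_nhdsWithin_im_pos (x : ℝ) :
    Tendsto (fun y : ℝ => (⟨x, y⟩ : ℂ)) (𝓝[>] 0) (𝓝[{z | 0 < z.im}] (x : ℂ)) := by
  refine tendsto_nhdsWithin_iff.2 ⟨?_, eventually_mem_nhdsWithin⟩
  have : Continuous fun y : ℝ => (⟨x, y⟩ : ℂ) := by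
    have h : (fun y : ℝ => (⟨x, y⟩ : ℂ)) = fun y : ℝ => (x : ℂ) + y * Complex.I := by
      exact funext fun y => Complex.ext (by simp) (by simp)
    rw [h]
    fun_prop
  exact (this.tendsto 0).mono_left nhdsWithin_le_nhds

variable [IsProbabilityMeasure lam]

lemma tendsto_cauchyT_im
    (hsol : ∀ z : ℂ, z.im ≠ 0 → IsShiftedRoot U p₀ p₁ z (cauchyT lam z)) {x κ : ℝ}
    (hroot : ∀ w, IsShiftedRoot U p₀ p₁ x w → w.im ≤ κ → w.im ≤ 0)
    (hκ : ∀ᶠ z in 𝓝[{z | 0 < z.im}] (x : ℂ), (cauchyT lam z).im ≤ κ) :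
    Tendsto (fun y : ℝ => (cauchyT lam ⟨x, y⟩).im) (𝓝[>] 0) (𝓝 0) := by
  refine Tendsto.comp (g := fun z => (cauchyT lam z).im) ?_ (tendsto_mk_nhdsWithin_im_pos x)
  rw [tendsto_order]
  refine ⟨fun a ha => ?_, fun ε hε => ?_⟩
  · filter_upwards [eventually_mem_nhdsWithin] with z hz
    exact ha.trans_le (cauchyT_im_nonneg lam hz)
  · by_contra hc
    rw [not_eventually] at hc
    obtain ⟨w, ⟨hw1, hw2⟩, hw⟩ := exists_isShiftedRoot_of_frequently hsol
      (S := {w | ε ≤ w.im} ∩ {w | w.im ≤ κ})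
      ((isClosed_le continuous_const Complex.continuous_im).inter
        (isClosed_le Complex.continuous_im continuous_const))
      ((hc.and_eventually hκ).mono fun z hz => ⟨not_lt.1 hz.1, hz.2⟩)
    exact (hroot w hw hw2).not_gt (hε.trans_le hw1)

lemma notMem_support_of_tendsto {x r : ℝ} (hr : 0 < r)
    (h : ∀ t ∈ Ioo (x - r) (x + r),
      Tendsto (fun y : ℝ => (cauchyT lam ⟨t, y⟩).im) (𝓝[>] 0) (𝓝 0)) : x ∉ lam.support := by
  rw [Measure.notMem_support_iff_exists]
  refine ⟨Ioc (x - r / 2) (x + r / 2), Ioc_mem_nhds (by linarith) (by linarith), ?_⟩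
  exact measure_Ioc_eq_zero_of_tendsto lam h ⟨by linarith, by linarith⟩
    ⟨by linarith, by linarith⟩ (by linarith)

lemma notMem_support_of_spectralDiscr_pos
    (hsol : ∀ z : ℂ, z.im ≠ 0 → IsShiftedRoot U p₀ p₁ z (cauchyT lam z)) {x : ℝ}
    (hD : 0 < (spectralDiscr U p₀ p₁).eval x) : x ∉ lam.support := by
  obtain ⟨r, hr, hball⟩ := Metric.eventually_nhds_iff_ball.1
    ((spectralDiscr U p₀ p₁).continuous.continuousAt.eventually (lt_mem_nhds hD))
  rw [Real.ball_eq_Ioo] at hball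
  refine notMem_support_of_tendsto hr fun t ht =>
    tendsto_cauchyT_im (κ := shiftedRootBound U p₀ p₁ t + 1) hsol
      (fun w hw _ => (hw.im_eq_zero (hball t ht)).le) ?_
  filter_upwards [nhdsWithin_le_nhds ((continuous_shiftedRootBound U p₀ p₁).continuousAt.eventually
    (gt_mem_nhds (lt_add_one _))), eventually_mem_nhdsWithin] with z hz hz0
  exact ((Complex.im_le_norm _).trans (hsol z (ne_of_gt hz0)).norm_le).trans hz.le

/-- Where the discriminant does not vanish, the support is locally everything or nothing. -/
lemma notMem_frontier_support
    (hsol : ∀ z : ℂ, z.im ≠ 0 → IsShiftedRoot U p₀ p₁ z (cauchyT lam z)) {x₀ : ℝ}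
    (hD : (spectralDiscr U p₀ p₁).eval x₀ ≠ 0) : x₀ ∉ frontier lam.support := by
  obtain ⟨κ, hκ, hgap⟩ := exists_eventually_im_eq_zero_or_lt hD
  obtain ⟨r₁, hr₁, hgap⟩ := Metric.eventually_nhds_iff_ball.1 hgap
  have hne : ∀ᶠ z in 𝓝[{z | 0 < z.im}] (x₀ : ℂ), (cauchyT lam z).im ≠ κ := by
    by_contra hc
    rw [not_eventually] at hc
    obtain ⟨w, hw1, hw⟩ := exists_isShiftedRoot_of_frequently hsol (S := {w | w.im = κ})
      (isClosed_eq Complex.continuous_im continuous_const) (hc.mono fun z hz => not_not.1 hz)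
    have hw1 : w.im = κ := hw1
    rcases hgap x₀ (Metric.mem_ball_self hr₁) w hw with h | h
    · exact hκ.ne' (hw1 ▸ h)
    · rw [hw1, abs_of_pos hκ] at h
      exact h.false
  rw [eventually_nhdsWithin_iff] at hne
  obtain ⟨r₂, hr₂, hne⟩ := Metric.eventually_nhds_iff_ball.1 hne
  set r := min r₁ r₂ with hr
  have hr0 : 0 < r := lt_min hr₁ hr₂
  set H : Set ℂ := Metric.ball (x₀ : ℂ) r ∩ {z | 0 < z.im} with hH
  have hpre : IsPreconnected ((fun z => (cauchyT lam z).im) '' H) := by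
    refine IsPreconnected.image ?_ _ fun z hz =>
      (Complex.continuous_im.continuousAt.comp
        (continuousAt_cauchyT lam hz.2)).continuousWithinAt
    exact ((convex_ball _ _).inter (convex_halfSpace_im_gt 0)).isPreconnected
  have hcases := hpre.subset_or_subset isOpen_Iio isOpen_Ioi
    (disjoint_left.2 fun _ h₁ h₂ => lt_asymm h₁ h₂)
    (show _ ⊆ Iio κ ∪ Ioi κ by
      rintro _ ⟨z, hz, rfl⟩
      exact lt_or_gt_of_ne
        (hne z (Metric.ball_subset_ball (min_le_right _ _) hz.1) hz.2))
  rcases hcases with hlow | hhigh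
  · have hx : x₀ ∉ lam.support := by
      refine notMem_support_of_tendsto hr0 fun t ht => tendsto_cauchyT_im (κ := κ) hsol ?_ ?_
      · intro w hw hwκ
        rw [← Real.ball_eq_Ioo] at ht
        rcases hgap t (Metric.ball_subset_ball (min_le_left _ _) ht) w hw with h | h
        · exact h.le
        · by_contra! hpos
          rw [abs_of_pos hpos] at h
          exact h.not_ge hwκ
      · have hmem : Metric.ball (x₀ : ℂ) r ∈ 𝓝 (t : ℂ) := by
          refine Metric.isOpen_ball.mem_nhds ?_
          rw [← Real.ball_eq_Ioo, Metric.mem_ball] at ht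
          rwa [Metric.mem_ball, Complex.dist_of_im_eq (by simp), Complex.ofReal_re,
            Complex.ofReal_re]
        filter_upwards [nhdsWithin_le_nhds hmem, eventually_mem_nhdsWithin] with z hz hz0
        exact le_of_lt (hlow ⟨z, ⟨hz, hz0⟩, rfl⟩)
    rw [Measure.isClosed_support.frontier_eq]
    exact fun h => hx h.1
  · have hsub : Ioo (x₀ - r) (x₀ + r) ⊆ lam.support := by
      intro t ht
      by_contra hts
      obtain ⟨ρ, hρ, hnull⟩ : ∃ ρ > 0, lam (Ioo (t - ρ) (t + ρ)) = 0 := by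
        obtain ⟨N, hN, hN0⟩ := Measure.notMem_support_iff_exists.1 hts
        obtain ⟨ρ, hρ, hsub⟩ := Metric.mem_nhds_iff.1 hN
        exact ⟨ρ, hρ, measure_mono_null (Real.ball_eq_Ioo t ρ ▸ hsub) hN0⟩
      rw [← Real.ball_eq_Ioo, Metric.mem_ball, Real.dist_eq] at ht
      obtain ⟨y, hy, hy2⟩ := exists_between
        (lt_min (by positivity : 0 < κ * ρ ^ 2) (sub_pos.2 ht))
      have hzH : (⟨t, y⟩ : ℂ) ∈ H := by
        refine ⟨?_, hy⟩
        rw [Metric.mem_ball, Complex.dist_eq]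
        refine (Complex.norm_le_abs_re_add_abs_im _).trans_lt ?_
        simp only [Complex.sub_re, Complex.sub_im, Complex.ofReal_re, Complex.ofReal_im, sub_zero,
          abs_of_pos hy]
        linarith [hy2.trans_le (min_le_right _ _)]
      have h1 : κ < (cauchyT lam ⟨t, y⟩).im := hhigh ⟨_, hzH, rfl⟩
      have h2 := cauchyT_im_le_of_null lam hρ hy hnull
      have h3 : y / ρ ^ 2 ≤ κ := by
        rw [div_le_iff₀ (by positivity)]
        exact (hy2.trans_le (min_le_left _ _)).le
      linarith
    rw [Measure.isClosed_support.frontier_eq]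
    exact fun h => h.2 (mem_interior.2
      ⟨_, hsub, isOpen_Ioo, by linarith, by linarith⟩)

/-- A probability measure with algebraic Cauchy transform and bounded support has a Lipschitz
distribution function. -/
lemma exists_measureReal_Ioc_le
    (hsol : ∀ z : ℂ, z.im ≠ 0 → IsShiftedRoot U p₀ p₁ z (cauchyT lam z)) {R : ℝ}
    (hR : lam.support ⊆ Icc (-R) R) :
    ∃ M : NNReal, ∀ p q, p ≤ q → lam.real (Ioc p q) ≤ M * (q - p) := by
  obtain ⟨M, hM⟩ := ((isCompact_Icc (a := -R - 1) (b := R + 1)).reProdIm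
    (isCompact_Icc (a := (0 : ℝ)) (b := 1))).exists_bound_of_continuousOn
    (continuous_shiftedRootBound U p₀ p₁).continuousOn
  refine ⟨Real.toNNReal (max M 1), fun p q hpq => ?_⟩
  rw [Real.coe_toNNReal _ (le_max_of_le_right one_pos.le)]
  rcases hpq.eq_or_lt with rfl | hlt
  · simp
  rcases le_or_gt 2 (q - p) with h2 | h2
  · have h1 : lam.real (Ioc p q) ≤ 1 := measureReal_le_one
    nlinarith [le_max_right M 1]
  set x := (p + q) / 2 with hx
  set y := (q - p) / 2 with hy
  have hy0 : 0 < y := by linarith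
  have hsub : Ioc p q ⊆ Icc (x - y) (x + y) := fun s hs =>
    ⟨by linarith [hs.1], by linarith [hs.2]⟩
  by_cases hxR : x ∈ Icc (-R - 1) (R + 1)
  · have h3 : ‖shiftedRootBound U p₀ p₁ ⟨x, y⟩‖ ≤ M := hM _ ⟨hxR, hy0.le, by linarith⟩
    have h4 : (cauchyT lam ⟨x, y⟩).im ≤ M :=
      ((Complex.im_le_norm _).trans (hsol _ hy0.ne').norm_le).trans ((le_abs_self _).trans h3)
    calc lam.real (Ioc p q) ≤ lam.real (Icc (x - y) (x + y)) := measureReal_mono hsub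
      _ ≤ 2 * y * (cauchyT lam ⟨x, y⟩).im := measureReal_Icc_le_cauchyT_im lam x hy0
      _ ≤ 2 * y * max M 1 := by gcongr; exact h4.trans (le_max_left _ _)
      _ = max M 1 * (q - p) := by rw [hy]; ring
  · have hnull : lam (Ioc p q) = 0 := by
      refine measure_mono_null (t := lam.supportᶜ) (fun s hs hss => hxR ?_)
        Measure.measure_compl_support
      have h5 := hR hss
      have h6 := hsub hs
      exact ⟨by linarith [h5.1, h6.2], by linarith [h5.2, h6.1]⟩
    rw [measureReal_def, hnull, ENNReal.toReal_zero]
    exact mul_nonneg (le_max_of_le_right one_pos.le) (by linarith)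

end CauchyTransform

lemma AdmissibleSpectralCurve.isShiftedRoot {V p₀ p₁ : ℝ[X]} {a α : ℝ} {lam : Measure ℝ}
    (h : AdmissibleSpectralCurve V a α p₀ p₁ lam) (z : ℂ) (hz : z.im ≠ 0) :
    IsShiftedRoot V.derivative p₀ p₁ z (cauchyT lam z) :=
  h.hsol z hz

lemma AdmissibleSpectralCurve.exists_discr_pos {V p₀ p₁ : ℝ[X]} {a α : ℝ} {lam : Measure ℝ}
    (h : AdmissibleSpectralCurve V a α p₀ p₁ lam) :
    ∃ R : ℝ, ∀ x, R ≤ |x| → 0 < (spectralDiscr V.derivative p₀ p₁).eval x := by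
  have hm := h.hdeg
  have hV : V ≠ 0 := by
    rintro rfl
    simp at hm
  refine exists_spectralDiscr_pos (n := V.natDegree - 1) (u := vcoef V V.natDegree) (by omega)
    (natDegree_derivative_le V) ?_ ?_ h.ha ((natDegree_le_iff_degree_le.2 h.hp₁).trans (by omega))
    h.hp₀deg h.hp₀top
  · rw [coeff_derivative, vcoef, show V.natDegree - 1 + 1 = V.natDegree by omega, mul_comm]
    congr 1
    exact_mod_cast (by omega : V.natDegree - 1 + 1 = V.natDegree)
  · exact mul_ne_zero (by exact_mod_cast (by omega : V.natDegree ≠ 0))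
      (leadingCoeff_ne_zero.2 hV)

lemma MeasureTheory.Measure.exists_mem_support_ne {lam : Measure ℝ} [NullSingletonClass lam] {x : ℝ}
    (hx : x ∈ lam.support) {ε : ℝ} (hε : 0 < ε) : ∃ y ∈ lam.support, y ≠ x ∧ |y - x| < ε := by
  have hpos : 0 < lam (Metric.ball x ε \ {x}) := by
    rw [measure_sdiff_null (measure_singleton x)]
    exact (Measure.mem_support_iff_forall x).1 hx _ (Metric.ball_mem_nhds x hε)
  obtain ⟨y, ⟨hy, hyx⟩, hys⟩ := Measure.nonempty_inter_support_of_pos hpos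
  exact ⟨y, hys, hyx, hy⟩

/-- **The measure `λ` of an admissible spectral curve is absolutely continuous with
bounded density, and its support is a finite union of disjoint compact intervals.** -/
theorem stmt15 (V : Polynomial ℝ) (a α : ℝ) (p₀ p₁ : Polynomial ℝ) (lam : Measure ℝ)
    (h : AdmissibleSpectralCurve V a α p₀ p₁ lam) :
    (∃ (f : ℝ → ℝ) (Cb : ℝ), Measurable f ∧ (∀ x, 0 ≤ f x) ∧ (∀ x, f x ≤ Cb) ∧
      lam = volume.withDensity (fun x => ENNReal.ofReal (f x))) ∧
    ∃ (l : ℕ) (A B : Fin l → ℝ), 1 ≤ l ∧ (∀ i, A i < B i) ∧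
      (∀ i j : Fin l, (i : ℕ) < (j : ℕ) → B i < A j) ∧
      lam ((⋃ i, Set.Icc (A i) (B i))ᶜ) = 0 ∧
      ∀ x ∈ ⋃ i, Set.Icc (A i) (B i), ∀ ε : ℝ, 0 < ε →
        0 < lam (Set.Ioo (x - ε) (x + ε)) := by
  have := h.hprob
  have hsol := h.isShiftedRoot
  obtain ⟨R, hR⟩ := h.exists_discr_pos
  have hsupp : lam.support ⊆ Icc (-R) R := fun x hx => by
    by_contra hc
    refine notMem_support_of_spectralDiscr_pos hsol (hR x ?_) hx
    rw [mem_Icc, ← abs_le] at hc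
    exact (not_le.1 hc).le
  obtain ⟨M, hM⟩ := exists_measureReal_Ioc_le hsol hsupp
  obtain ⟨f, hf, hf0, hfM, hlam⟩ := exists_bounded_density lam M hM
  refine ⟨⟨f, M, hf, hf0, hfM, hlam⟩, ?_⟩
  have hatoms : NullSingletonClass lam := by
    rw [hlam]
    infer_instance
  have hDne : spectralDiscr V.derivative p₀ p₁ ≠ 0 := fun h0 => by
    simpa [h0] using hR |R| (by rw [abs_abs]; exact le_abs_self R)
  have hfin : (frontier lam.support).Finite :=
    (finite_setOfPred_isRoot hDne).subset fun x hx => by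
      by_contra hc
      exact notMem_frontier_support hsol hc hx
  obtain ⟨l, A, B, hAB, hBA, hK⟩ :=
    (isCompact_Icc.of_isClosed_subset Measure.isClosed_support hsupp).exists_eq_iUnion_Icc hfin
      fun x hx ε hε => Measure.exists_mem_support_ne hx hε
  refine ⟨l, A, B, ?_, hAB, hBA, ?_, ?_⟩
  · rw [Nat.one_le_iff_ne_zero]
    rintro rfl
    obtain ⟨x, hx⟩ := Measure.nonempty_support (IsProbabilityMeasure.ne_zero lam)
    simp [hK] at hx
  · rw [← hK]
    exact Measure.measure_compl_support
  · rw [← hK]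
    intro x hx ε hε
    exact (Measure.mem_support_iff_forall x).1 hx _ (Ioo_mem_nhds (by linarith) (by linarith))
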